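/- arXiv:1011.6007 — 2 statements merged into one kernel-verified Lean document; each statement's English description precedes it below -/
import Mathlib

section
/- Let k be an algebraically closed field, let r be a positive integer, and let R = (k⟦t⟧)^r be the product of r copies of the formal power series ring in one variable over k. Let S be a k-subalgebra of R which is a local ring and whose colength δ = dim_k(R/S) is finite. Then S is a Noetherian local ring and its embedding dimension, i.e. the dimension of m_S/m_S² over the residue field of S, is at most (δ+1)². -/
open PowerSeries

theorem aux_dim {k R : Type*} [Field k] [CommRing R] [Algebra k R] (A : Submodule k R)
    [FiniteDimensional k (R ⧸ A)] (x : R) (hx : Function.Injective (LinearMap.mulLeft k x))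
    (hA : A ≤ LinearMap.range (LinearMap.mulLeft k x))
    (hxA : A.map (LinearMap.mulLeft k x) ≤ A) :
    ∃ (d : ℕ) (b : Fin d → R), d ≤ Module.finrank k (R ⧸ A) ∧ (∀ i, b i ∈ A) ∧
      A ≤ Submodule.span k (Set.range b) ⊔ A.map (LinearMap.mulLeft k x) := by
  set f := LinearMap.mulLeft k x with hf
  set C := A.map f with hC
  set B := LinearMap.range f with hB
  have hCB : C ≤ B := hxA.trans hA
  -- induced map R/A → R/C
  let g : (R ⧸ A) →ₗ[k] (R ⧸ C) := A.mapQ C f (Submodule.map_le_iff_le_comap.1 le_rfl)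
  have hg : Function.Injective g := by
    rw [← LinearMap.ker_eq_bot]
    simp only [g]
    rw [Submodule.ker_mapQ, hC, Submodule.comap_map_eq_of_injective hx]
    simp
  have hgr : LinearMap.range g = B.map C.mkQ := by
    simp only [g]
    rw [Submodule.range_mapQ]
  have hBfin : FiniteDimensional k (R ⧸ B) :=
    Module.Finite.of_surjective (A.factor hA) (Submodule.factor_surjective hA)
  have hBle : Module.finrank k (R ⧸ B) ≤ Module.finrank k (R ⧸ A) :=
    LinearMap.finrank_le_finrank_of_surjective (f := A.factor hA) (Submodule.factor_surjective hA)
  have hfin1 : FiniteDimensional k (B.map C.mkQ) := by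
    rw [← hgr]; infer_instance
  have hfin2 : FiniteDimensional k ((R ⧸ C) ⧸ (B.map C.mkQ)) :=
    Module.Finite.equiv (Submodule.quotientQuotientEquivQuotient C B hCB).symm
  have hfin : FiniteDimensional k (R ⧸ C) := Module.Finite.of_submodule_quotient (B.map C.mkQ)
  have e1 := Submodule.finrank_quotient_add_finrank (B.map C.mkQ)
  have e2 := Submodule.finrank_quotient_add_finrank (A.map C.mkQ)
  rw [(Submodule.quotientQuotientEquivQuotient C B hCB).finrank_eq, ← hgr,
    LinearMap.finrank_range_of_inj hg] at e1
  rw [(Submodule.quotientQuotientEquivQuotient C A hxA).finrank_eq] at e2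
  let bs := Module.finBasis k (A.map C.mkQ)
  have hb : ∀ i, ∃ a ∈ A, C.mkQ a = bs i := fun i => (bs i).2
  choose b hbA hbe using hb
  refine ⟨_, b, ?_, hbA, ?_⟩
  · omega
  · intro a ha
    have h1 : (⟨C.mkQ a, Submodule.mem_map_of_mem ha⟩ : A.map C.mkQ) ∈
        Submodule.span k (Set.range bs) := by rw [bs.span_eq]; trivial
    have h2 := Submodule.mem_map_of_mem (f := (A.map C.mkQ).subtype) h1
    rw [Submodule.map_span, ← Set.range_comp] at h2
    have h3 : ((A.map C.mkQ).subtype ∘ bs : _ → R ⧸ C) = C.mkQ ∘ b := by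
      ext i; simp [hbe]
    rw [h3, Set.range_comp, ← Submodule.map_span] at h2
    obtain ⟨s, hs, hse⟩ := h2
    have : a - s ∈ C := by
      rw [← Submodule.Quotient.mk_eq_zero, Submodule.Quotient.mk_sub]
      simpa [sub_eq_zero] using hse.symm
    rw [← add_sub_cancel s a]
    exact Submodule.add_mem_sup hs this

theorem aux_pow {k R : Type*} [Field k] [CommRing R] [Algebra k R] (x : R)
    [FiniteDimensional k (R ⧸ LinearMap.range (LinearMap.mulLeft k x))] (n : ℕ) :
    ∃ V : Submodule k R, V.FG ∧ ∀ a : R, ∃ v ∈ V, ∃ c, a = v + x ^ n * c := by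
  induction n with
  | zero => exact ⟨⊥, Submodule.fg_bot, fun a => ⟨0, by simp, a, by simp⟩⟩
  | succ n ih =>
    obtain ⟨V, hV, h⟩ := ih
    obtain ⟨W, hW, hW'⟩ : ∃ W : Submodule k R, W.FG ∧
        ∀ a : R, ∃ v ∈ W, ∃ c, a = v + x * c := by
      obtain ⟨W, hW⟩ := Submodule.exists_isCompl (LinearMap.range (LinearMap.mulLeft k x))
      refine ⟨W, ?_, fun a => ?_⟩
      · have := Module.Finite.equiv (Submodule.quotientEquivOfIsCompl _ W hW)
        exact Module.Finite.iff_fg.1 this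
      · have : a ∈ W ⊔ LinearMap.range (LinearMap.mulLeft k x) := by
          rw [sup_comm, hW.sup_eq_top]; trivial
        obtain ⟨v, hv, _, ⟨c, rfl⟩, e⟩ := Submodule.mem_sup.1 this
        exact ⟨v, hv, c, by rw [← e]; rfl⟩
    refine ⟨V ⊔ W.map (LinearMap.mulLeft k (x ^ n)), hV.sup (hW.map _), fun a => ?_⟩
    obtain ⟨v, hv, c, rfl⟩ := h a
    obtain ⟨w, hw, e, rfl⟩ := hW' c
    exact ⟨v + x ^ n * w, Submodule.add_mem_sup hv ⟨w, hw, rfl⟩, e, by ring⟩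

theorem aux_noeth {k R : Type*} [Field k] [CommRing R] [IsPrincipalIdealRing R] [Algebra k R]
    (S : Subalgebra k R) (y : R) (hy : ∀ c, y * c ∈ S) (V : Submodule k R) (hV : V.FG)
    (h : ∀ a : R, ∃ v ∈ V, ∃ c, a = v + y * c) : IsNoetherianRing S := by
  classical
  rw [isNoetherianRing_iff_ideal_fg]
  intro I
  have hfg : (Ideal.span ((fun s : S => (s : R)) '' I)).FG := IsNoetherian.noetherian _
  obtain ⟨T, hTI, hT⟩ := Submodule.fg_span_iff_fg_span_finset_subset _ |>.1 hfg
  obtain ⟨T', hT'I, rfl⟩ := Finset.subset_set_image_iff.1 hTI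
  obtain ⟨g, hg⟩ := (IsPrincipalIdealRing.principal (Ideal.span ((fun s : S => (s : R)) '' I)))
  have hgJ : ∀ c ∈ Ideal.span ((fun s : S => (s : R)) '' I),
      ∀ r, ∃ s ∈ Ideal.span (T' : Set S), (s : R) = y * (r * c) := by
    intro c hc
    change c ∈ Submodule.span R _ at hc
    rw [hT] at hc
    induction hc using Submodule.span_induction with
    | mem c hc =>
      simp only [Finset.coe_image, Set.mem_image] at hc
      obtain ⟨s, hs, rfl⟩ := hc
      exact fun r => ⟨⟨y * r, hy r⟩ * s, Ideal.mul_mem_left _ _ (Ideal.subset_span hs),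
        by simp [mul_assoc]⟩
    | zero => exact fun r => ⟨0, by simp, by simp⟩
    | add a b _ _ ha hb =>
      intro r
      obtain ⟨s, hs, e⟩ := ha r
      obtain ⟨t, ht, e'⟩ := hb r
      exact ⟨s + t, add_mem hs ht, by simp [e, e', mul_add]⟩
    | smul r a _ ha =>
      intro q
      obtain ⟨s, hs, e⟩ := ha (q * r)
      exact ⟨s, hs, by rw [e, smul_eq_mul]; ring⟩
  let W : Submodule k S := (V.map (LinearMap.mulLeft k g)).comap S.val.toLinearMap ⊓
    I.restrictScalars k
  have hWfg : W.FG := by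
    have hf : FiniteDimensional k (V.map (LinearMap.mulLeft k g)) :=
      Module.Finite.iff_fg.2 (hV.map _)
    have hsub : W.map S.val.toLinearMap ≤ V.map (LinearMap.mulLeft k g) := by
      rw [Submodule.map_le_iff_le_comap]; exact inf_le_left
    have := Submodule.finiteDimensional_of_le hsub
    exact Submodule.fg_of_fg_map_injective S.val.toLinearMap Subtype.val_injective
      (Module.Finite.iff_fg.1 this)
  obtain ⟨T2, hT2⟩ := hWfg
  refine ⟨T' ∪ T2, le_antisymm ?_ ?_⟩
  · rw [Submodule.span_le, Finset.coe_union, Set.union_subset_iff]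
    refine ⟨hT'I, fun t ht => ?_⟩
    have : t ∈ W := hT2 ▸ Submodule.subset_span ht
    exact this.2
  · intro a ha
    have hga : (a : R) ∈ Ideal.span ((fun s : S => (s : R)) '' I) :=
      Ideal.subset_span ⟨a, ha, rfl⟩
    have hgg : g ∈ Ideal.span ((fun s : S => (s : R)) '' I) := by
      rw [hg]; exact Submodule.mem_span_singleton_self g
    rw [hg] at hga
    obtain ⟨q, hq⟩ := Submodule.mem_span_singleton.1 hga
    obtain ⟨v, hv, c, rfl⟩ := h q
    obtain ⟨s, hs, e⟩ := hgJ g hgg c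
    have hsI : s ∈ I := (Ideal.span_le.2 hT'I) hs
    have hw : a - s ∈ W := by
      refine ⟨⟨v, hv, ?_⟩, I.sub_mem ha hsI⟩
      simp only [smul_eq_mul] at hq
      simp only [LinearMap.mulLeft_apply, AlgHom.toLinearMap_apply, map_sub, Subalgebra.coe_val]
      rw [← hq, e]; ring
    rw [← add_sub_cancel s a, Finset.coe_union, Ideal.span, Submodule.span_union]
    refine Submodule.add_mem_sup hs ?_
    rw [← hT2] at hw
    exact Submodule.span_le_restrictScalars k S _ hw

theorem aux_cot {S : Type*} [CommRing S] [IsLocalRing S] {d : ℕ} (b : Fin d → S)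
    (hb : ∀ i, b i ∈ IsLocalRing.maximalIdeal S)
    (h : ∀ z ∈ IsLocalRing.maximalIdeal S, ∃ c : Fin d → S, ∃ x ∈ IsLocalRing.maximalIdeal S,
      ∃ w ∈ IsLocalRing.maximalIdeal S, z = ∑ i, c i * b i + x * w) :
    Module.finrank (IsLocalRing.ResidueField S) (IsLocalRing.CotangentSpace S) ≤ d := by
  let bm : Fin d → IsLocalRing.maximalIdeal S := fun i => ⟨b i, hb i⟩
  let β : Fin d → IsLocalRing.CotangentSpace S := fun i =>
    (IsLocalRing.maximalIdeal S).toCotangent (bm i)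
  have htop : Submodule.span (IsLocalRing.ResidueField S) (Set.range β) = ⊤ := by
    rw [eq_top_iff]
    intro z _
    obtain ⟨⟨m, hm⟩, rfl⟩ := Ideal.toCotangent_surjective _ z
    obtain ⟨c, x, hx, w, hw, e⟩ := h m hm
    have key : (IsLocalRing.maximalIdeal S).toCotangent ⟨m, hm⟩ =
        (IsLocalRing.maximalIdeal S).toCotangent (∑ i, c i • bm i) := by
      rw [Ideal.toCotangent_eq, pow_two]
      have : m - ((∑ i, c i • bm i : IsLocalRing.maximalIdeal S) : S) = x * w := by
        rw [e]; simp [bm]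
      simp only [this]
      exact Ideal.mul_mem_mul hx hw
    rw [key, map_sum]
    refine Submodule.sum_mem _ fun i _ => ?_
    rw [map_smul, ← IsScalarTower.algebraMap_smul (IsLocalRing.ResidueField S)]
    exact Submodule.smul_mem _ _ (Submodule.subset_span ⟨i, rfl⟩)
  have := finrank_range_le_card (R := IsLocalRing.ResidueField S) β
  rw [Set.finrank, htop, finrank_top] at this
  simpa using this

theorem aux_infinite (k : Type*) [Field k] : ¬ Module.Finite k k⟦X⟧ := by
  intro h
  have := IsArtinianRing.of_finite k k⟦X⟧
  have hF := IsArtinianRing.isField_of_isDomain k⟦X⟧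
  exact PowerSeries.not_isField hF

section
variable {k : Type*} [Field k] {r : ℕ}
    (S : Subalgebra k (Fin r → PowerSeries k)) [IsLocalRing S]

theorem aux_mem_max (i : Fin r) (s : S) :
    s ∈ IsLocalRing.maximalIdeal S ↔ constantCoeff ((s : Fin r → k⟦X⟧) i) = 0 := by
  let φ : S →+* k := (constantCoeff (R := k)).comp ((Pi.evalRingHom _ i).comp S.val.toRingHom)
  have hφ : Function.Surjective φ := fun c => ⟨algebraMap k S c, by
    change constantCoeff (algebraMap k k⟦X⟧ c) = c
    rw [PowerSeries.algebraMap_apply]; simp⟩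
  have := RingHom.ker_isMaximal_of_surjective φ hφ
  rw [← IsLocalRing.eq_maximalIdeal this]
  rfl

/-- The maximal ideal as a subspace of the ambient ring. -/
noncomputable def auxA : Submodule k (Fin r → PowerSeries k) :=
  ((IsLocalRing.maximalIdeal S).restrictScalars k).map S.val.toLinearMap

theorem mem_auxA (f : Fin r → k⟦X⟧) :
    f ∈ auxA S ↔ ∃ h : f ∈ S, (⟨f, h⟩ : S) ∈ IsLocalRing.maximalIdeal S := by
  constructor
  · rintro ⟨s, hs, rfl⟩
    exact ⟨s.2, hs⟩
  · rintro ⟨h, hm⟩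
    exact ⟨_, hm, rfl⟩

variable [FiniteDimensional k ((Fin r → PowerSeries k) ⧸ Subalgebra.toSubmodule S)]

theorem aux_nonzero (i : Fin r) : ∃ f ∈ auxA S, f i ≠ 0 := by
  let L : k⟦X⟧ →ₗ[k] (Fin r → k⟦X⟧) :=
    (LinearMap.single k (fun _ : Fin r => k⟦X⟧) i).comp (LinearMap.mulLeft k (X : k⟦X⟧))
  let Φ := (Subalgebra.toSubmodule S).mkQ.comp L
  have hΦ : ¬ Function.Injective Φ := fun h => aux_infinite k (Module.Finite.of_injective Φ h)
  rw [← LinearMap.ker_eq_bot, ← ne_eq, Submodule.ne_bot_iff] at hΦ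
  obtain ⟨g, hg, hg0⟩ := hΦ
  have hS : L g ∈ S := by
    have : Φ g = 0 := hg
    simpa [Φ] using this
  have hLi : L g i = X * g := by simp [L]
  refine ⟨L g, (mem_auxA S _).2 ⟨hS, (aux_mem_max S i _).2 ?_⟩, ?_⟩
  · simp [hLi]
  · rw [hLi]; exact mul_ne_zero PowerSeries.X_ne_zero hg0

theorem aux_exists_x [IsAlgClosed k] : ∃ x ∈ auxA S, (∀ i, x i ≠ 0) ∧ ∀ f ∈ auxA S, ∃ c, f = x * c := by
  classical
  have hex : ∀ i, ∃ n, ∃ f ∈ auxA S, coeff n (f i) ≠ 0 := by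
    intro i
    obtain ⟨f, hf, h⟩ := aux_nonzero S i
    obtain ⟨n, hn⟩ := (PowerSeries.exists_coeff_ne_zero_iff_ne_zero).2 h
    exact ⟨n, f, hf, hn⟩
  let a : Fin r → ℕ := fun i => Nat.find (hex i)
  have ha : ∀ i, ∃ f ∈ auxA S, coeff (a i) (f i) ≠ 0 := fun i => Nat.find_spec (hex i)
  have hmin : ∀ i, ∀ f ∈ auxA S, ∀ j < a i, coeff j (f i) = 0 := by
    intro i f hf j hj
    have := Nat.find_min (hex i) hj
    push Not at this
    exact this f hf
  let p : Fin r → Submodule k (auxA S) := fun i =>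
    LinearMap.ker (((coeff (R := k) (a i)).comp (LinearMap.proj i)).comp (auxA S).subtype)
  have hp : ∀ i, p i ≠ ⊤ := by
    intro i h
    obtain ⟨f, hf, hne⟩ := ha i
    have : (⟨f, hf⟩ : auxA S) ∈ p i := h ▸ Submodule.mem_top
    exact hne this
  have : ∃ x : auxA S, ∀ i, x ∉ p i := by
    by_contra! hcon
    obtain ⟨i, hi⟩ := Subspace.exists_eq_top_of_iUnion_eq_univ (p := p)
      (Set.eq_univ_of_forall fun x => Set.mem_iUnion.2 (hcon x))
    exact hp i hi
  obtain ⟨⟨x, hxA⟩, hx⟩ := this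
  have hx' : ∀ i, coeff (a i) (x i) ≠ 0 := hx
  refine ⟨x, hxA, fun i h => hx' i (by simp [h]), fun f hf => ?_⟩
  have hdvd : ∀ i, x i ∣ f i := by
    intro i
    obtain ⟨u, hu⟩ := PowerSeries.X_pow_dvd_iff.2 (hmin i x hxA)
    obtain ⟨v, hv⟩ := PowerSeries.X_pow_dvd_iff.2 (hmin i f hf)
    have hu' : IsUnit u := by
      rw [PowerSeries.isUnit_iff_constantCoeff, isUnit_iff_ne_zero]
      have := hx' i
      rw [hu] at this
      simpa [PowerSeries.coeff_X_pow_mul'] using this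
    rw [hu, hv]
    exact mul_dvd_mul_left _ (hu'.dvd)
  choose c hc using hdvd
  exact ⟨c, funext hc⟩

theorem aux_conductor (x : Fin r → k⟦X⟧) (hx : x ∈ auxA S) : ∃ n : ℕ, ∀ c, x ^ n * c ∈ S := by
  obtain ⟨hxS, hxm⟩ := (mem_auxA S x).1 hx
  set B := Subalgebra.toSubmodule S with hB
  let φ : Module.End k ((Fin r → k⟦X⟧) ⧸ B) := B.mapQ B (LinearMap.mulLeft k x)
    (fun b hb => S.mul_mem hxS hb)
  have hpow : ∀ (p : Polynomial k) (c : Fin r → k⟦X⟧),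
      Polynomial.aeval φ p (B.mkQ c) = B.mkQ (Polynomial.aeval x p * c) := by
    intro p
    induction p using Polynomial.induction_on' with
    | add p q hp hq => intro c; simp only [map_add, LinearMap.add_apply, hp, hq, add_mul]
    | monomial n a =>
      intro c
      simp only [Polynomial.aeval_monomial, mul_assoc, Module.End.mul_apply,
        Module.algebraMap_end_apply]
      rw [← Algebra.smul_def, map_smul]
      congr 1
      induction n generalizing c with
      | zero => simp
      | succ n ih =>
        rw [pow_succ, Module.End.mul_apply, pow_succ, mul_assoc]
        exact ih (x * c)
  have hp0 : minpoly k φ ≠ 0 := minpoly.ne_zero (Algebra.IsIntegral.isIntegral φ)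
  obtain ⟨q, hq, hnd⟩ := Polynomial.exists_eq_pow_rootMultiplicity_mul_and_not_dvd _ hp0 0
  rw [map_zero, sub_zero] at hq hnd
  set n := Polynomial.rootMultiplicity 0 (minpoly k φ)
  rw [Polynomial.X_dvd_iff] at hnd
  set xs : S := ⟨x, hxS⟩
  have hu : IsUnit (Polynomial.aeval xs q) := by
    by_contra hcon
    have h1 : Polynomial.aeval xs q ∈ IsLocalRing.maximalIdeal S :=
      (IsLocalRing.mem_maximalIdeal _).2 hcon
    have h2 : Polynomial.aeval xs q =
        Polynomial.aeval xs q.divX * xs + algebraMap k S (q.coeff 0) := by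
      conv_lhs => rw [← Polynomial.divX_mul_X_add q]
      simp
    rw [h2] at h1
    have h3 := (Ideal.add_mem_iff_right _ (Ideal.mul_mem_left _ _ hxm)).1 h1
    exact (IsLocalRing.mem_maximalIdeal _).1 h3 ((isUnit_iff_ne_zero.2 hnd).map (algebraMap k S))
  obtain ⟨v, hv⟩ := hu.exists_right_inv
  have hval : (Polynomial.aeval xs q : Fin r → k⟦X⟧) = Polynomial.aeval x q :=
    (Polynomial.aeval_algHom_apply S.val xs q).symm
  refine ⟨n, fun c => ?_⟩
  have h4 := hpow (minpoly k φ) c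
  rw [minpoly.aeval, LinearMap.zero_apply, eq_comm, ← LinearMap.mem_ker, Submodule.ker_mkQ, hq,
    map_mul, map_pow, Polynomial.aeval_X] at h4
  have h5 := S.mul_mem v.2 h4
  have h6 : Polynomial.aeval x q * (v : Fin r → k⟦X⟧) = 1 := by
    rw [← hval]; exact congrArg Subtype.val hv
  have h7 : (v : Fin r → k⟦X⟧) * (x ^ n * Polynomial.aeval x q * c) = x ^ n * c := by
    linear_combination (x ^ n * c) * h6
  rwa [h7] at h5

theorem aux_finrank (i : Fin r) : FiniteDimensional k ((Fin r → k⟦X⟧) ⧸ auxA S) ∧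
    Module.finrank k ((Fin r → k⟦X⟧) ⧸ auxA S) ≤
      Module.finrank k ((Fin r → k⟦X⟧) ⧸ Subalgebra.toSubmodule S) + 1 := by
  set B := Subalgebra.toSubmodule S
  have hle : auxA S ≤ B := fun f hf => ((mem_auxA S f).1 hf).1
  have h1 : B.map (auxA S).mkQ ≤ Submodule.span k {(auxA S).mkQ 1} := by
    rintro _ ⟨b, hb, rfl⟩
    refine Submodule.mem_span_singleton.2 ⟨constantCoeff (b i), ?_⟩
    rw [← map_smul, ← sub_eq_zero, ← map_sub, ← LinearMap.mem_ker, Submodule.ker_mkQ, mem_auxA]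
    refine ⟨B.sub_mem (B.smul_mem _ S.one_mem) hb, (aux_mem_max S i _).2 ?_⟩
    simp
  have hf1 : FiniteDimensional k (B.map (auxA S).mkQ) := Submodule.finiteDimensional_of_le h1
  have hf2 : FiniteDimensional k (((Fin r → k⟦X⟧) ⧸ auxA S) ⧸ B.map (auxA S).mkQ) :=
    Module.Finite.equiv (Submodule.quotientQuotientEquivQuotient (auxA S) B hle).symm
  have hf : FiniteDimensional k ((Fin r → k⟦X⟧) ⧸ auxA S) :=
    Module.Finite.of_submodule_quotient (B.map (auxA S).mkQ)
  refine ⟨hf, ?_⟩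
  have e := Submodule.finrank_quotient_add_finrank (B.map (auxA S).mkQ)
  rw [(Submodule.quotientQuotientEquivQuotient (auxA S) B hle).finrank_eq] at e
  have h2 := Submodule.finrank_mono h1
  have h3 := finrank_span_le_card (R := k) ({(auxA S).mkQ 1} : Set ((Fin r → k⟦X⟧) ⧸ auxA S))
  simp only [Set.toFinset_singleton, Finset.card_singleton] at h3
  omega

end

theorem curve_singularity_embDim_le_sq
    (k : Type*) [Field k] [IsAlgClosed k] (r : ℕ) (hr : 0 < r)
    (S : Subalgebra k (Fin r → PowerSeries k)) [IsLocalRing S]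
    [FiniteDimensional k ((Fin r → PowerSeries k) ⧸ Subalgebra.toSubmodule S)] :
    IsNoetherianRing S ∧
      Module.finrank (IsLocalRing.ResidueField S) (IsLocalRing.CotangentSpace S) ≤
        (Module.finrank k ((Fin r → PowerSeries k) ⧸ Subalgebra.toSubmodule S) + 1) ^ 2 := by
  obtain ⟨x, hxA, hx0, hxdvd⟩ := aux_exists_x S
  obtain ⟨hfin, hle⟩ := aux_finrank S ⟨0, hr⟩
  have hAx : auxA S ≤ LinearMap.range (LinearMap.mulLeft k x) := fun f hf => by
    obtain ⟨c, rfl⟩ := hxdvd f hf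
    exact ⟨c, rfl⟩
  obtain ⟨hxS, hxm⟩ := (mem_auxA S x).1 hxA
  constructor
  · have : FiniteDimensional k ((Fin r → k⟦X⟧) ⧸ LinearMap.range (LinearMap.mulLeft k x)) :=
      Module.Finite.of_surjective ((auxA S).factor hAx) (Submodule.factor_surjective hAx)
    obtain ⟨n, hn⟩ := aux_conductor S x hxA
    obtain ⟨V, hV, hV'⟩ := aux_pow (k := k) x n
    exact aux_noeth S _ hn V hV hV'
  · have hinj : Function.Injective (LinearMap.mulLeft k x) := by
      intro a b hab
      funext i
      have := congrFun hab i
      simp only [LinearMap.mulLeft_apply, Pi.mul_apply] at this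
      exact mul_left_cancel₀ (hx0 i) this
    have hxA' : (auxA S).map (LinearMap.mulLeft k x) ≤ auxA S := by
      rintro _ ⟨f, hf, rfl⟩
      obtain ⟨hfS, hfm⟩ := (mem_auxA S f).1 hf
      exact (mem_auxA S _).2 ⟨S.mul_mem hxS hfS,
        Ideal.mul_mem_left (IsLocalRing.maximalIdeal S) ⟨x, hxS⟩ hfm⟩
    obtain ⟨d, b, hd, hbA, hspan⟩ := aux_dim (auxA S) x hinj hAx hxA'
    have hb' := fun i => (mem_auxA S _).1 (hbA i)
    choose hbS hbm using hb'
    have h2 := aux_cot (fun i => (⟨b i, hbS i⟩ : S)) hbm (fun z hz => by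
      have h1 := hspan ((mem_auxA S z).2 ⟨z.2, hz⟩)
      obtain ⟨u, hu, _, ⟨w, hw, rfl⟩, e⟩ := Submodule.mem_sup.1 h1
      obtain ⟨c, rfl⟩ := (Submodule.mem_span_range_iff_exists_fun k).1 hu
      obtain ⟨hwS, hwm⟩ := (mem_auxA S w).1 hw
      refine ⟨fun i => algebraMap k S (c i), ⟨x, hxS⟩, hxm, ⟨w, hwS⟩, hwm, Subtype.ext ?_⟩
      rw [← e]
      simp [Algebra.smul_def])
    nlinarith
end

section
/- Let k be a field and let S be a k-subalgebra of the formal power series ring k⟦t⟧ whose colength δ = dim_k(k⟦t⟧/S) is finite. Then S is a local ring and its embedding dimension, i.e. the dimension of m_S/m_S² over the residue field of S, is at most δ + 1. -/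
theorem ubs_inv_mem
    {k : Type*} [Field k] (S : Subalgebra k (PowerSeries k))
    [FiniteDimensional k (PowerSeries k ⧸ Subalgebra.toSubmodule S)]
    (u : PowerSeries k) (hu : u ∈ S) (h0 : PowerSeries.constantCoeff u ≠ 0) : u⁻¹ ∈ S := by
  have hle : Subalgebra.toSubmodule S ≤
      (Subalgebra.toSubmodule S).comap (LinearMap.mulLeft k u) := fun s hs => S.mul_mem hu hs
  have huu : u * u⁻¹ = 1 := PowerSeries.mul_inv_cancel u h0
  have hsurj : Function.Surjective
      ((Subalgebra.toSubmodule S).mapQ (Subalgebra.toSubmodule S) (LinearMap.mulLeft k u) hle) := by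
    intro y
    obtain ⟨y, rfl⟩ := Submodule.Quotient.mk_surjective _ y
    refine ⟨Submodule.Quotient.mk (u⁻¹ * y), ?_⟩
    rw [Submodule.mapQ_apply, LinearMap.mulLeft_apply, ← mul_assoc, huu, one_mul]
  have hinj := LinearMap.injective_iff_surjective.mpr hsurj
  have : (Submodule.Quotient.mk (u⁻¹) : PowerSeries k ⧸ Subalgebra.toSubmodule S) = 0 := by
    apply hinj
    rw [Submodule.mapQ_apply, LinearMap.mulLeft_apply, huu, map_zero,
      Submodule.Quotient.mk_eq_zero]
    exact S.one_mem
  exact (Submodule.Quotient.mk_eq_zero _).1 this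

theorem ubs_isUnit_iff
    {k : Type*} [Field k] (S : Subalgebra k (PowerSeries k))
    [FiniteDimensional k (PowerSeries k ⧸ Subalgebra.toSubmodule S)]
    (u : S) : IsUnit u ↔ PowerSeries.constantCoeff (u : PowerSeries k) ≠ 0 := by
  constructor
  · intro h
    exact ((h.map S.val).map (PowerSeries.constantCoeff (R := k))).ne_zero
  · intro h
    exact IsUnit.of_mul_eq_one ⟨_, ubs_inv_mem S u u.2 h⟩
      (Subtype.ext (PowerSeries.mul_inv_cancel (u : PowerSeries k) h))

theorem ubs_finrank {k V W U : Type*} [Field k] [AddCommGroup V] [Module k V]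
    [AddCommGroup W] [Module k W] [FiniteDimensional k W] [AddCommGroup U] [Module k U]
    (θ : V →ₗ[k] W) (ψ : V →ₗ[k] U) (hψ : Function.Surjective ψ)
    (h : LinearMap.ker θ ≤ LinearMap.ker ψ) :
    FiniteDimensional k U ∧ Module.finrank k U ≤ Module.finrank k W := by
  have e := θ.quotKerEquivRange
  haveI : FiniteDimensional k (V ⧸ LinearMap.ker θ) := e.symm.finiteDimensional
  have hs : Function.Surjective ((LinearMap.ker θ).liftQ ψ h) := by
    intro y
    obtain ⟨v, rfl⟩ := hψ y
    exact ⟨Submodule.Quotient.mk v, rfl⟩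
  refine ⟨Module.Finite.of_surjective _ hs, ?_⟩
  calc Module.finrank k U ≤ Module.finrank k (V ⧸ LinearMap.ker θ) :=
        LinearMap.finrank_le_finrank_of_surjective hs
    _ = Module.finrank k (LinearMap.range θ) := e.finrank_eq
    _ ≤ _ := Submodule.finrank_le _

theorem ubs_exists_gen {k : Type*} [Field k] (A : Set (PowerSeries k)) (hA : A.Nonempty) :
    ∃ x ∈ A, ∀ y ∈ A, x ∣ y := by
  obtain ⟨x, hx, hmin⟩ : ∃ x ∈ A, ∀ y ∈ A, PowerSeries.order x ≤ PowerSeries.order y := by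
    obtain ⟨_, ⟨x, hx, rfl⟩, h⟩ :=
      (wellFounded_lt (α := ℕ∞)).has_min (PowerSeries.order '' A) (hA.image _)
    exact ⟨x, hx, fun y hy => not_lt.1 (h _ ⟨y, hy, rfl⟩)⟩
  refine ⟨x, hx, fun y hy => ?_⟩
  rcases ValuationRing.dvd_total x y with h | ⟨c, hc⟩
  · exact h
  · by_cases hy0 : y = 0
    · simp [hy0]
    have h1 := hmin y hy
    rw [hc, PowerSeries.order_mul] at h1
    have h2 : PowerSeries.order c = 0 := by
      have : PowerSeries.order y ≠ ⊤ := by simpa using hy0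
      generalize PowerSeries.order y = a at *
      generalize PowerSeries.order c = b at *
      lift a to ℕ using this
      have : b ≠ ⊤ := by rintro rfl; simp at h1
      lift b to ℕ using this
      norm_cast at *
      omega
    have hcu : IsUnit c := by
      rw [PowerSeries.isUnit_iff_constantCoeff, isUnit_iff_ne_zero]
      intro h3
      have := PowerSeries.order_ne_zero_iff_constCoeff_eq_zero.2 h3
      exact this h2
    rw [hc]
    exact (hcu.mul_right_dvd).2 dvd_rfl

/-- **Unibranched case of Lemma 5.1.** Let `k` be a field and `S` a `k`-subalgebra of `k⟦t⟧`
of finite colength `δ = dim_k (k⟦t⟧ / S)`.  Then `S` is a local ring and its embedding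
dimension (the dimension of `m_S / m_S²` over the residue field) is at most `δ + 1`. -/
theorem unibranch_singularity_embDim_le
    (k : Type*) [Field k] (S : Subalgebra k (PowerSeries k))
    [FiniteDimensional k (PowerSeries k ⧸ Subalgebra.toSubmodule S)] :
    IsLocalRing S ∧
      ∀ [IsLocalRing S],
        Module.finrank (IsLocalRing.ResidueField S) (IsLocalRing.CotangentSpace S) ≤
          Module.finrank k (PowerSeries k ⧸ Subalgebra.toSubmodule S) + 1 := by
  refine ⟨?_, ?_⟩
  · refine IsLocalRing.of_nonunits_add fun a b ha hb => ?_
    rw [mem_nonunits_iff, ubs_isUnit_iff, not_not] at *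
    simp [ha, hb]
  · intro _
    have hmem : ∀ s : S, s ∈ IsLocalRing.maximalIdeal S ↔
        PowerSeries.constantCoeff (s : PowerSeries k) = 0 := by
      intro s
      rw [IsLocalRing.mem_maximalIdeal, mem_nonunits_iff, ubs_isUnit_iff, not_not]
    obtain ⟨x, ⟨hxS, hx0⟩, hx⟩ := ubs_exists_gen
      {f : PowerSeries k | f ∈ S ∧ PowerSeries.constantCoeff f = 0} ⟨0, S.zero_mem, by simp⟩
    let N : Submodule k (PowerSeries k) :=
      (Subalgebra.toSubmodule S).comap (LinearMap.mulLeft k x)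
    let xm : S := ⟨x, hxS⟩
    have hxm : xm ∈ IsLocalRing.maximalIdeal S := (hmem _).2 hx0
    let μ : N →ₗ[k] IsLocalRing.maximalIdeal S :=
      { toFun := fun r => ⟨⟨x * r.1, r.2⟩, (hmem _).2 (by simp [hx0])⟩
        map_add' := fun a b => by ext1; ext1; simp [mul_add]
        map_smul' := fun a b => by ext1; ext1; simp }
    let ψ : N →ₗ[k] (IsLocalRing.maximalIdeal S).Cotangent :=
      ((IsLocalRing.maximalIdeal S).toCotangent.restrictScalars k).comp μ
    let θ : N →ₗ[k] (PowerSeries k ⧸ Subalgebra.toSubmodule S) × k :=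
      ((Subalgebra.toSubmodule S).mkQ.prod (PowerSeries.coeff 0)).comp N.subtype
    have hψ : Function.Surjective ψ := by
      intro y
      obtain ⟨y, rfl⟩ := Ideal.toCotangent_surjective _ y
      obtain ⟨c, hc⟩ := hx y.1.1 ⟨y.1.2, (hmem _).1 y.2⟩
      refine ⟨⟨c, ?_⟩, ?_⟩
      · change x * c ∈ S
        rw [← hc]; exact y.1.2
      · change (IsLocalRing.maximalIdeal S).toCotangent _ = _
        congr 1
        ext1; ext1
        exact hc.symm
    have hker : LinearMap.ker θ ≤ LinearMap.ker ψ := by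
      intro r hr
      have hr' : θ r = 0 := hr
      have h1 : r.1 ∈ S := (Submodule.Quotient.mk_eq_zero _).1 (congrArg Prod.fst hr')
      have h2 : PowerSeries.constantCoeff r.1 = 0 := by
        rw [← PowerSeries.coeff_zero_eq_constantCoeff_apply]
        exact congrArg Prod.snd hr'
      change (IsLocalRing.maximalIdeal S).toCotangent _ = 0
      rw [Ideal.toCotangent_eq_zero, pow_two]
      exact Ideal.mul_mem_mul hxm ((hmem ⟨r.1, h1⟩).2 h2)
    obtain ⟨hfin, hle⟩ := ubs_finrank θ ψ hψ hker
    rw [Module.finrank_prod, Module.finrank_self] at hle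
    refine le_trans ?_ hle
    haveI : IsScalarTower k (IsLocalRing.ResidueField S) (IsLocalRing.CotangentSpace S) := by
      refine IsScalarTower.of_algebraMap_smul fun r m => ?_
      rw [IsScalarTower.algebraMap_apply k S (IsLocalRing.ResidueField S), algebraMap_smul,
        algebraMap_smul]
    haveI : FiniteDimensional k (IsLocalRing.CotangentSpace S) := hfin
    exact Module.finrank_top_le_finrank_of_isScalarTower k (IsLocalRing.ResidueField S) (IsLocalRing.CotangentSpace S)
end
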